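/- If F ⊆ ℕ → ℕ is bounded with respect to ≤*, then the van Douwen space X_F is metrizable. -/

import Mathlib

/-- The underlying type of the van Douwen space `X_F`:
the disjoint union `F ⊔ ℕ ⊔ (F × ℕ × ℕ)`. -/
def VDSpace (F : Set (ℕ → ℕ)) : Type := (↥F ⊕ ℕ) ⊕ (↥F × ℕ × ℕ)

namespace VDSpace

variable {F : Set (ℕ → ℕ)}

/-- The (isolated) points of `X_F` coming from `F × ℕ × ℕ`. -/
def pt (p : ↥F × ℕ × ℕ) : VDSpace F := Sum.inr p

/-- The points of `X_F` coming from functions in `F`. -/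
def fn (f : ↥F) : VDSpace F := Sum.inl (Sum.inl f)

/-- The points of `X_F` coming from natural numbers. -/
def nat (k : ℕ) : VDSpace F := Sum.inl (Sum.inr k)

/-- The basic neighborhood `O_{f,s} = {f} ∪ {(f, m, n) : f m = n, (m, n) ∉ s}` of `fn f`. -/
def basicO (f : ↥F) (s : Finset (ℕ × ℕ)) : Set (VDSpace F) :=
  {fn f} ∪ {x | ∃ m n : ℕ, (f : ℕ → ℕ) m = n ∧ (m, n) ∉ s ∧ x = pt (f, m, n)}

/-- The basic neighborhood `U_{k,n} = {k} ∪ {(g, k, l) : g ∈ F, l ≥ n}` of `nat k`. -/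
def basicU (k n : ℕ) : Set (VDSpace F) :=
  {nat k} ∪ {x | ∃ (g : ↥F) (l : ℕ), n ≤ l ∧ x = pt (g, k, l)}

/-- The topology of the van Douwen space: every point of `F × ℕ × ℕ` is isolated,
the sets `O_{f,s}` form a neighborhood basis of `f ∈ F`, and the sets `U_{k,n}` form a
neighborhood basis of `k ∈ ℕ`. -/
instance instTopVD (F : Set (ℕ → ℕ)) : TopologicalSpace (VDSpace F) :=
  TopologicalSpace.generateFrom
    ({V | ∃ p : ↥F × ℕ × ℕ, V = {pt p}} ∪
     {V | ∃ (f : ↥F) (s : Finset (ℕ × ℕ)), V = basicO f s} ∪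
     {V | ∃ k n : ℕ, V = (basicU k n : Set (VDSpace F))})

end VDSpace

/-- `f ≤* g`: eventual domination, i.e. `f n ≤ g n` for all but finitely many `n`. -/
def EvLE (f g : ℕ → ℕ) : Prop := ∀ᶠ n in Filter.atTop, f n ≤ g n

/-- A topology generated by `g` is metrizable if its points carry a weight `w ≥ 0` and a label `c`
such that points of positive weight are isolated, a label determines its point of weight zero, and
points of weight zero are approached exactly by points of small weight with the same label. -/
theorem metrizableSpace_generateFrom_of_weight {X Y : Type*} {g : Set (Set X)} (w : X → ℝ)
    (c : X → Y) (hw : ∀ x, 0 ≤ w x)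
    (hc : ∀ x y, w x = 0 → w y = 0 → c x = c y → x = y)
    (isolated : ∀ x, 0 < w x → {x} ∈ g)
    (exists_lt_mem : ∀ V ∈ g, ∀ x ∈ V, w x = 0 →
      ∃ ε > 0, ∀ y, c y = c x → w y < ε → y ∈ V)
    (exists_mem_lt : ∀ x, w x = 0 → ∀ ε > 0,
      ∃ V ∈ g, x ∈ V ∧ ∀ y ∈ V, c y = c x ∧ w y < ε) :
    @TopologicalSpace.MetrizableSpace X (TopologicalSpace.generateFrom g) := by
  classical
  let d : X → X → ℝ := fun x y =>
    if x = y then 0 else w x + w y + if c x = c y then 0 else 1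
  let M : MetricSpace X :=
    { dist := d
      dist_self := fun x => by simp [d]
      dist_comm := fun x y => by simp only [d, eq_comm, add_comm]
      dist_triangle := fun x y z => by
        have hx := hw x
        have hy := hw y
        have hz := hw z
        simp only [d]
        split_ifs <;> first | linarith | simp_all
      eq_of_dist_eq_zero := fun {x y} h => by
        by_contra hxy
        have hx := hw x
        have hy := hw y
        simp only [d, if_neg hxy] at h
        split_ifs at h with hcxy
        · exact hxy (hc x y (by linarith) (by linarith) hcxy)
        · linarith }
  have hd : ∀ x y : X, dist x y = d x y := fun _ _ => rfl
  suffices M.toUniformSpace.toTopologicalSpace = TopologicalSpace.generateFrom g from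
    this ▸ inferInstance
  apply le_antisymm
  · refine le_generateFrom fun V hV => Metric.isOpen_iff.2 fun x hx => ?_
    rcases (hw x).eq_or_lt with h0 | hpos
    · obtain ⟨ε, hε, h⟩ := exists_lt_mem V hV x hx h0.symm
      refine ⟨min ε 1, by positivity, fun y hy => ?_⟩
      rw [Metric.mem_ball, hd, lt_min_iff] at hy
      by_cases hyx : y = x
      · exact hyx ▸ hx
      · have hwy := hw y
        simp only [d, if_neg hyx] at hy
        split_ifs at hy with hcyx
        · exact h y hcyx (by linarith)
        · linarith
    · refine ⟨w x, hpos, fun y hy => ?_⟩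
      rw [Metric.mem_ball, hd] at hy
      by_cases hyx : y = x
      · exact hyx ▸ hx
      · have hwy := hw y
        simp only [d, if_neg hyx] at hy
        split_ifs at hy <;> linarith
  · intro U hU
    rw [@isOpen_iff_forall_mem_open X (TopologicalSpace.generateFrom g)]
    intro x hx
    rcases (hw x).eq_or_lt with h0 | hpos
    · obtain ⟨ε, hε, hball⟩ := Metric.isOpen_iff.1 hU x hx
      obtain ⟨V, hV, hxV, h⟩ := exists_mem_lt x h0.symm ε hε
      refine ⟨V, fun y hy => hball ?_, TopologicalSpace.isOpen_generateFrom_of_mem hV, hxV⟩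
      obtain ⟨hcyx, hlt⟩ := h y hy
      rw [Metric.mem_ball, hd]
      simp only [d, if_pos hcyx, ← h0]
      split_ifs <;> linarith
    · exact ⟨{x}, Set.singleton_subset_iff.2 hx,
        TopologicalSpace.isOpen_generateFrom_of_mem (isolated x hpos), rfl⟩

namespace VDSpace

variable {F : Set (ℕ → ℕ)}

/-- The weight of a point of `X_F`, which vanishes exactly at the non-isolated points. -/
noncomputable def weight : VDSpace F → ℝ
  | Sum.inl _ => 0
  | Sum.inr (_, m, n) => 1 / ((m + n : ℕ) + 1 : ℝ)

open Classical in
/-- The centre of a point of `X_F`, given a function `g` with `f m ≤ g m` for all `f ∈ F` and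
`m ≥ N f`: an isolated point is attached to `f ∈ F` if it lies on the graph of `f` beyond `N f`, to
`m ∈ ℕ` if it lies above the graph of `g` in column `m`, and to itself otherwise. -/
noncomputable def center (g : ℕ → ℕ) (N : F → ℕ) : VDSpace F → VDSpace F
  | Sum.inl a => Sum.inl a
  | Sum.inr (f, m, n) =>
    if (f : ℕ → ℕ) m = n ∧ N f ≤ m then fn f else if g m < n then nat m else pt (f, m, n)

@[simp] theorem weight_fn (f : F) : weight (fn f) = 0 := rfl

@[simp] theorem weight_nat (k : ℕ) : weight (nat k : VDSpace F) = 0 := rfl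

theorem weight_pt (f : F) (m n : ℕ) : weight (pt (f, m, n)) = 1 / ((m + n : ℕ) + 1 : ℝ) := rfl

theorem weight_pt_pos (p : F × ℕ × ℕ) : 0 < weight (pt p) := by
  obtain ⟨f, m, n⟩ := p
  exact Nat.one_div_pos_of_nat

theorem weight_pt_lt_one_div {f : F} {m n K : ℕ} :
    weight (pt (f, m, n)) < 1 / ((K : ℝ) + 1) ↔ K < m + n := by
  rw [weight_pt, one_div_lt_one_div (by positivity) (by positivity)]
  simp only [add_lt_add_iff_right, Nat.cast_lt]

@[elab_as_elim]
theorem cases_points {P : VDSpace F → Prop} (x : VDSpace F) (hfn : ∀ f, P (fn f))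
    (hnat : ∀ k, P (nat k)) (hpt : ∀ f m n, P (pt (f, m, n))) : P x :=
  match x with
  | Sum.inl (Sum.inl f) => hfn f
  | Sum.inl (Sum.inr k) => hnat k
  | Sum.inr (f, m, n) => hpt f m n

@[simp] theorem fn_inj {f f' : F} : fn f = fn f' ↔ f = f' := by simp [fn, VDSpace]

@[simp] theorem nat_inj {k k' : ℕ} : (nat k : VDSpace F) = nat k' ↔ k = k' := by
  simp [nat, VDSpace]

@[simp] theorem pt_inj {p p' : F × ℕ × ℕ} : pt p = pt p' ↔ p = p' := by simp [pt, VDSpace]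

@[simp] theorem fn_ne_nat {f : F} {k : ℕ} : fn f ≠ nat k := by simp [fn, nat, VDSpace]

@[simp] theorem nat_ne_fn {f : F} {k : ℕ} : nat k ≠ fn f := fn_ne_nat.symm

@[simp] theorem fn_ne_pt {f : F} {p : F × ℕ × ℕ} : fn f ≠ pt p := by simp [fn, pt, VDSpace]

@[simp] theorem pt_ne_fn {f : F} {p : F × ℕ × ℕ} : pt p ≠ fn f := fn_ne_pt.symm

@[simp] theorem nat_ne_pt {k : ℕ} {p : F × ℕ × ℕ} : nat k ≠ pt p := by simp [nat, pt, VDSpace]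

@[simp] theorem pt_ne_nat {k : ℕ} {p : F × ℕ × ℕ} : pt p ≠ nat k := nat_ne_pt.symm

section center

variable (g : ℕ → ℕ) (N : F → ℕ)

@[simp] theorem center_fn (f : F) : center g N (fn f) = fn f := rfl

@[simp] theorem center_nat (k : ℕ) : center g N (nat k) = nat k := rfl

open Classical in
theorem center_pt (f : F) (m n : ℕ) : center g N (pt (f, m, n)) =
    if (f : ℕ → ℕ) m = n ∧ N f ≤ m then fn f else if g m < n then nat m else pt (f, m, n) := rfl

variable {g N}

theorem center_pt_eq_fn {f f' : F} {m n : ℕ} :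
    center g N (pt (f', m, n)) = fn f ↔ f' = f ∧ (f : ℕ → ℕ) m = n ∧ N f ≤ m := by
  rw [center_pt]
  split_ifs <;> grind [fn_inj, nat_ne_fn, pt_ne_fn]

theorem center_pt_eq_nat (hN : ∀ f : F, ∀ m ≥ N f, (f : ℕ → ℕ) m ≤ g m) {f : F} {k m n : ℕ} :
    center g N (pt (f, m, n)) = nat k ↔ m = k ∧ g m < n := by
  have := hN f m
  rw [center_pt]
  split_ifs <;> grind [nat_inj, fn_ne_nat, pt_ne_nat]

end center

@[simp] theorem fn_mem_basicO {f f' : F} {s : Finset (ℕ × ℕ)} :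
    fn f' ∈ basicO f s ↔ f' = f := by simp [basicO]

@[simp] theorem nat_notMem_basicO {f : F} {s : Finset (ℕ × ℕ)} {k : ℕ} :
    nat k ∉ basicO f s := by simp [basicO]

@[simp] theorem pt_mem_basicO {f f' : F} {s : Finset (ℕ × ℕ)} {m n : ℕ} :
    pt (f', m, n) ∈ basicO f s ↔ f' = f ∧ (f : ℕ → ℕ) m = n ∧ (m, n) ∉ s := by
  simp only [basicO, Set.mem_union, Set.mem_singleton_iff, pt_ne_fn, Set.mem_ofPred_eq, pt_inj,
    Prod.mk.injEq, false_or]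
  grind

@[simp] theorem nat_mem_basicU {k k' n : ℕ} :
    (nat k' : VDSpace F) ∈ basicU k n ↔ k' = k := by simp [basicU]

@[simp] theorem fn_notMem_basicU {f : F} {k n : ℕ} : fn f ∉ basicU k n := by simp [basicU]

@[simp] theorem pt_mem_basicU {f : F} {k n m l : ℕ} :
    pt (f, m, l) ∈ basicU k n ↔ m = k ∧ n ≤ l := by
  simp only [basicU, Set.mem_union, Set.mem_singleton_iff, pt_ne_nat, Set.mem_ofPred_eq, pt_inj,
    Prod.mk.injEq, false_or]
  constructor
  · rintro ⟨g, l', hl, -, rfl, rfl⟩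
    exact ⟨rfl, hl⟩
  · rintro ⟨rfl, hl⟩
    exact ⟨f, l, hl, rfl, rfl, rfl⟩

theorem exists_lt_mem_basicO (g : ℕ → ℕ) (N : F → ℕ) (f : F) (s : Finset (ℕ × ℕ)) :
    ∃ ε > 0, ∀ y, center g N y = fn f → weight y < ε → y ∈ basicO f s := by
  refine ⟨1 / ((s.sup fun p => p.1 + p.2 : ℕ) + 1 : ℝ), Nat.one_div_pos_of_nat, fun y => ?_⟩
  refine cases_points y (by simp) (by simp) fun f' m n h hlt => ?_
  rw [weight_pt_lt_one_div] at hlt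
  obtain ⟨rfl, hn, -⟩ := center_pt_eq_fn.1 h
  refine pt_mem_basicO.2 ⟨rfl, hn, fun hs => hlt.not_ge ?_⟩
  exact Finset.le_sup (f := fun p : ℕ × ℕ => p.1 + p.2) hs

theorem exists_lt_mem_basicU {g : ℕ → ℕ} {N : F → ℕ}
    (hN : ∀ f : F, ∀ m ≥ N f, (f : ℕ → ℕ) m ≤ g m) (k n : ℕ) :
    ∃ ε > 0, ∀ y : VDSpace F, center g N y = nat k → weight y < ε → y ∈ basicU k n := by
  refine ⟨1 / ((k + n : ℕ) + 1 : ℝ), Nat.one_div_pos_of_nat, fun y => ?_⟩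
  refine cases_points y (by simp) (by simp) fun f m l h hlt => ?_
  rw [weight_pt_lt_one_div] at hlt
  obtain ⟨rfl, -⟩ := (center_pt_eq_nat hN).1 h
  exact pt_mem_basicU.2 ⟨rfl, by omega⟩

theorem exists_basicO_lt (g : ℕ → ℕ) (N : F → ℕ) (f : F) {ε : ℝ} (hε : 0 < ε) :
    ∃ s, ∀ y ∈ basicO f s, center g N y = fn f ∧ weight y < ε := by
  obtain ⟨K, hK⟩ := exists_nat_one_div_lt hε
  refine ⟨(Finset.range (max (N f) (K + 1))).image fun m => (m, (f : ℕ → ℕ) m), fun y => ?_⟩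
  refine cases_points y (by simp [hε]) (by simp) fun f' m n h => ?_
  obtain ⟨rfl, rfl, hs⟩ := pt_mem_basicO.1 h
  have hm : max (N f') (K + 1) ≤ m := by
    by_contra! hm
    exact hs (Finset.mem_image_of_mem _ (Finset.mem_range.2 hm))
  exact ⟨center_pt_eq_fn.2 ⟨rfl, rfl, by omega⟩,
    (weight_pt_lt_one_div.2 (by omega)).trans hK⟩

theorem exists_basicU_lt {g : ℕ → ℕ} {N : F → ℕ}
    (hN : ∀ f : F, ∀ m ≥ N f, (f : ℕ → ℕ) m ≤ g m) (k : ℕ) {ε : ℝ} (hε : 0 < ε) :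
    ∃ n, ∀ y ∈ (basicU k n : Set (VDSpace F)), center g N y = nat k ∧ weight y < ε := by
  obtain ⟨K, hK⟩ := exists_nat_one_div_lt hε
  refine ⟨max (g k + 1) (K + 1), fun y => ?_⟩
  refine cases_points y (by simp) (by simp [hε]) fun f m l h => ?_
  obtain ⟨rfl, hl⟩ := pt_mem_basicU.1 h
  exact ⟨(center_pt_eq_nat hN).2 ⟨rfl, by omega⟩,
    (weight_pt_lt_one_div.2 (by omega)).trans hK⟩

end VDSpace

/-- If `F ⊆ ℕ → ℕ` is bounded with respect to `≤*`, then the van Douwen space `X_F` is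
metrizable. -/
theorem vanDouwen_metrizable (F : Set (ℕ → ℕ))
    (hF : ∃ g : ℕ → ℕ, ∀ f ∈ F, EvLE f g) :
    TopologicalSpace.MetrizableSpace (VDSpace F) := by
  open VDSpace in
  obtain ⟨g, hg⟩ := hF
  choose N hN using fun f : F => Filter.eventually_atTop.1 (hg f f.2)
  refine metrizableSpace_generateFrom_of_weight weight (center g N) ?_ ?_ ?_ ?_ ?_
  · exact fun x => cases_points x (by simp) (by simp) fun f m n => (weight_pt_pos _).le
  · intro x y
    refine cases_points x (fun f => ?_) (fun k => ?_)
      fun f m n h => absurd h (weight_pt_pos _).ne'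
    all_goals
      refine cases_points y (fun f => ?_) (fun k => ?_)
        fun f m n _ h => absurd h (weight_pt_pos _).ne'
      all_goals simp
  · exact fun x => cases_points x (by simp) (by simp) fun f m n _ => Or.inl (Or.inl ⟨_, rfl⟩)
  · rintro V ((⟨p, rfl⟩ | ⟨f, s, rfl⟩) | ⟨k, n, rfl⟩) x
    · rintro rfl h
      exact absurd h (weight_pt_pos p).ne'
    · refine cases_points x (fun f' h _ => ?_) (by simp)
        fun f m n _ h => absurd h (weight_pt_pos _).ne'
      obtain rfl := fn_mem_basicO.1 h
      exact exists_lt_mem_basicO g N f' s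
    · refine cases_points x (by simp) (fun k' h _ => ?_)
        fun f m n _ h => absurd h (weight_pt_pos _).ne'
      obtain rfl := nat_mem_basicU.1 h
      exact exists_lt_mem_basicU hN k' n
  · intro x
    refine cases_points x (fun f _ ε hε => ?_) (fun k _ ε hε => ?_)
      fun f m n h => absurd h (weight_pt_pos _).ne'
    · obtain ⟨s, hs⟩ := exists_basicO_lt g N f hε
      exact ⟨_, Or.inl (Or.inr ⟨f, s, rfl⟩), fn_mem_basicO.2 rfl, hs⟩
    · obtain ⟨n, hn⟩ := exists_basicU_lt hN k hε
      exact ⟨_, Or.inr ⟨k, n, rfl⟩, nat_mem_basicU.2 rfl, hn⟩
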